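/- For every real number q with 0 < q < 1, the Virasoro minimal model character χ_{2,5}^{1,2} satisfies the Rogers–Ramanujan product identity χ_{2,5}^{1,2}(q) = q^{−1/60} · ∏_{n=0}^∞ 1/((1 − q^{5n+1})(1 − q^{5n+4})). Equivalently, (q)_∞^{−1} · Σ_{k∈ℤ} q^{10k²}(q^{k} − q^{9k+2}) = ∏_{n=0}^∞ 1/((1 − q^{5n+1})(1 − q^{5n+4})). -/

import Mathlib

open scoped BigOperators

/-- The Euler product `(q)_∞ = ∏_{i=1}^∞ (1 - q^i)`. -/
noncomputable def eulerProd (q : ℝ) : ℝ := ∏' i : ℕ, (1 - q ^ (i + 1))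

/-- The Virasoro minimal model character `χ_{s,t}^{m,n}(q)`:
`q^(h - c/24) · (q)_∞⁻¹ · Σ_{k∈ℤ} q^(s t k²) (q^(k(mt-ns)) - q^((mt+ns)k+mn))`,
where `c = 1 - 6(s-t)²/(st)` and `h = ((mt-ns)² - (s-t)²)/(4st)`. -/
noncomputable def minChar (s t m n : ℤ) (q : ℝ) : ℝ :=
  q ^ ((((((m * t - n * s) ^ 2 - (s - t) ^ 2 : ℤ) : ℝ)) / (4 * (s : ℝ) * (t : ℝ))) -
        (1 - 6 * ((s : ℝ) - (t : ℝ)) ^ 2 / ((s : ℝ) * (t : ℝ))) / 24) *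
    (eulerProd q)⁻¹ *
    ∑' k : ℤ, ((q ^ (s * t * k ^ 2 + k * (m * t - n * s)) : ℝ) -
               (q ^ (s * t * k ^ 2 + (m * t + n * s) * k + m * n) : ℝ))

/-- The finite `p`-Pochhammer product `(p; p)_n`. -/
noncomputable def qPoch (p : ℝ) (n : ℕ) : ℝ := ∏ i ∈ Finset.range n, (1 - p ^ (i + 1))

/-- Gaussian binomial coefficients, defined through the `q`-Pascal recursion. -/
noncomputable def gaussBinom (p : ℝ) : ℕ → ℕ → ℝ
  | _, 0 => 1
  | 0, _ + 1 => 0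
  | n + 1, k + 1 => p ^ (k + 1) * gaussBinom p n (k + 1) + gaussBinom p n k

lemma gaussBinom_zero_right (p : ℝ) (n : ℕ) : gaussBinom p n 0 = 1 := by
  cases n <;> rfl

lemma gaussBinom_succ_succ (p : ℝ) (n k : ℕ) : gaussBinom p (n + 1) (k + 1) =
    p ^ (k + 1) * gaussBinom p n (k + 1) + gaussBinom p n k := rfl

lemma gaussBinom_eq_zero_of_lt (p : ℝ) {n k : ℕ} (h : n < k) : gaussBinom p n k = 0 := by
  induction n generalizing k with
  | zero => obtain ⟨k, rfl⟩ := Nat.exists_eq_succ_of_ne_zero h.ne'; rfl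
  | succ n ih =>
    obtain ⟨k, rfl⟩ := Nat.exists_eq_succ_of_ne_zero (by omega : k ≠ 0)
    rw [Nat.succ_eq_add_one, gaussBinom_succ_succ, ih (by omega), ih (by omega)]
    simp

lemma qPoch_succ (p : ℝ) (n : ℕ) : qPoch p (n + 1) = qPoch p n * (1 - p ^ (n + 1)) :=
  Finset.prod_range_succ _ _

lemma gaussBinom_mul_qPoch (p : ℝ) (k m : ℕ) :
    gaussBinom p (k + m) k * (qPoch p k * qPoch p m) = qPoch p (k + m) := by
  induction h : k + m generalizing k m with
  | zero =>
    obtain ⟨rfl, rfl⟩ : k = 0 ∧ m = 0 := by omega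
    simp [gaussBinom_zero_right, qPoch]
  | succ n ih =>
    rcases k with _ | k
    · obtain rfl : m = n + 1 := by omega
      simp [gaussBinom_zero_right, qPoch]
    have h₁ := ih k m (by omega)
    rcases m with _ | m
    · obtain rfl : n = k := by omega
      rw [gaussBinom_succ_succ, gaussBinom_eq_zero_of_lt p (Nat.lt_succ_self n), qPoch_succ]
      linear_combination (1 - p ^ (n + 1)) * h₁
    have h₂ := ih (k + 1) m (by omega)
    obtain rfl : n = k + m + 1 := by omega
    rw [gaussBinom_succ_succ, qPoch_succ p (k + m + 1)]
    rw [qPoch_succ p m] at h₁ ⊢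
    rw [qPoch_succ p k] at h₂ ⊢
    linear_combination (1 - p ^ (k + 1)) * h₁ + p ^ (k + 1) * (1 - p ^ (m + 1)) * h₂

/-- The finite `q`-binomial theorem. -/
lemma prod_one_add_mul_pow (p x : ℝ) (n : ℕ) :
    ∏ i ∈ Finset.range n, (1 + x * p ^ i) =
      ∑ k ∈ Finset.range (n + 1), gaussBinom p n k * (p ^ k.choose 2 * x ^ k) := by
  induction n generalizing x with
  | zero => simp [gaussBinom_zero_right]
  | succ n ih =>
    have h : ∏ i ∈ Finset.range (n + 1), (1 + x * p ^ i) =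
        (∏ i ∈ Finset.range n, (1 + (x * p) * p ^ i)) * (1 + x) := by
      rw [Finset.prod_range_succ', pow_zero, mul_one]
      congr 1
      exact Finset.prod_congr rfl fun i _ ↦ by ring
    have h₀ : ∑ k ∈ Finset.range (n + 1), gaussBinom p n k * (p ^ k.choose 2 * (x * p) ^ k) =
        ∑ k ∈ Finset.range (n + 1),
          gaussBinom p n (k + 1) * (p ^ (k + 1).choose 2 * (x * p) ^ (k + 1)) + 1 := by
      have := Finset.sum_range_succ'
        (fun k ↦ gaussBinom p n k * (p ^ k.choose 2 * (x * p) ^ k)) (n + 1)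
      rw [Finset.sum_range_succ, gaussBinom_eq_zero_of_lt p (Nat.lt_succ_self n)] at this
      simpa [gaussBinom_zero_right] using this
    rw [h, ih, mul_add, mul_one, Finset.sum_range_succ' _ (n + 1), Finset.sum_mul]
    nth_rw 1 [h₀]
    rw [add_right_comm, ← Finset.sum_add_distrib]
    congr 1
    · refine Finset.sum_congr rfl fun k _ ↦ ?_
      have hc : (k + 1).choose 2 = k + k.choose 2 := by
        rw [Nat.choose_succ_succ' k 1, Nat.choose_one_right]
      rw [gaussBinom_succ_succ, hc]
      ring
    · simp [gaussBinom_zero_right]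

/-- The general term of the theta series `∑ (-1)^j q^(j(5j+1)/2)`. -/
noncomputable def thetaTerm (q : ℝ) (j : ℤ) : ℝ := (-1) ^ j * q ^ (j * (5 * j + 1) / 2)

lemma two_dvd_mul_five_mul_add_one (j : ℤ) : 2 ∣ j * (5 * j + 1) := by
  rcases Int.even_or_odd' j with ⟨m, rfl | rfl⟩
  · exact ⟨m * (5 * (2 * m) + 1), by ring⟩
  · exact ⟨(2 * m + 1) * (5 * m + 3), by ring⟩

lemma prod_neg_pow_five_mul_add_two (q : ℝ) (N : ℕ) :
    ∏ i ∈ Finset.range N, (-(q ^ (5 * i + 2))) = (-1) ^ N * q ^ (5 * N.choose 2 + 2 * N) := by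
  induction N with
  | zero => simp
  | succ N ih =>
    have hc : (N + 1).choose 2 = N + N.choose 2 := by
      rw [Nat.choose_succ_succ' N 1, Nat.choose_one_right]
    rw [Finset.prod_range_succ, ih, hc]
    ring

lemma cast_choose_two (n : ℕ) : 2 * (n.choose 2 : ℤ) = n * (n - 1) := by
  induction n with
  | zero => simp
  | succ n ih =>
    rw [Nat.choose_succ_succ' n 1, Nat.choose_one_right]
    push_cast
    linear_combination ih

lemma theta_coefficient (q : ℝ) (hq : q ≠ 0) (N k : ℕ) :
    (-1) ^ N * q ^ (5 * N.choose 2 + 2 * N) *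
      ((q ^ 5) ^ k.choose 2 * (-(q ^ (3 - 5 * (N : ℤ)))) ^ k) = thetaTerm q (k - N) := by
  unfold thetaTerm
  obtain ⟨e, he⟩ := two_dvd_mul_five_mul_add_one ((k : ℤ) - N)
  have hN := cast_choose_two N
  have hk := cast_choose_two k
  rw [he, Int.mul_ediv_cancel_left _ two_ne_zero]
  have hexp : e = ((5 * N.choose 2 + 2 * N : ℕ) : ℤ) + ((5 * k.choose 2 : ℕ) : ℤ) +
      (3 - 5 * (N : ℤ)) * k := by
    push_cast
    have : 2 * e = 2 * ((5 * N.choose 2 + 2 * N : ℤ) + 5 * k.choose 2 +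
      (3 - 5 * (N : ℤ)) * k) := by linear_combination -he - 5 * hN - 5 * hk
    linarith
  have hs : (-1 : ℝ) ^ ((k : ℤ) - N) = (-1) ^ N * (-1) ^ k := by
    rw [zpow_sub₀ (by norm_num), zpow_natCast, zpow_natCast, div_eq_mul_inv, mul_comm, ← inv_pow]
    norm_num
  rw [hs, hexp, zpow_add₀ hq, zpow_add₀ hq, zpow_natCast, zpow_natCast, zpow_mul, zpow_natCast,
    neg_pow (q ^ (3 - 5 * (N : ℤ))), pow_mul q 5]
  ring

/-- A finite form of the Jacobi triple product. -/
lemma prod_mul_prod_eq_sum_thetaTerm (q : ℝ) (hq : q ≠ 0) (N : ℕ) :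
    (∏ i ∈ Finset.range N, (1 - q ^ (5 * i + 2))) * ∏ i ∈ Finset.range N, (1 - q ^ (5 * i + 3)) =
      ∑ k ∈ Finset.range (2 * N + 1), gaussBinom (q ^ 5) (2 * N) k * thetaTerm q (k - N) := by
  have key := prod_one_add_mul_pow (q ^ 5) (-(q ^ (3 - 5 * (N : ℤ)))) (N + N)
  rw [Finset.prod_range_add, ← Finset.prod_range_reflect] at key
  have hp (i : ℕ) : ((q ^ 5) ^ i : ℝ) = q ^ (5 * (i : ℤ)) := by
    rw [← pow_mul, ← zpow_natCast]; push_cast; rfl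
  have h₁ : (∏ i ∈ Finset.range N, (-(q ^ (5 * i + 2)))) * ∏ i ∈ Finset.range N,
      (1 + -(q ^ (3 - 5 * (N : ℤ))) * (q ^ 5) ^ (N - 1 - i)) =
      ∏ i ∈ Finset.range N, (1 - q ^ (5 * i + 2)) := by
    rw [← Finset.prod_mul_distrib]
    refine Finset.prod_congr rfl fun i hi ↦ ?_
    have hi := Finset.mem_range.1 hi
    have h : q ^ (5 * i + 2) * (q ^ (3 - 5 * (N : ℤ)) * (q ^ 5) ^ (N - 1 - i)) = 1 := by
      rw [hp, ← zpow_natCast, ← zpow_add₀ hq, ← zpow_add₀ hq, ← zpow_zero q]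
      congr 1
      push_cast [Nat.sub_sub, Nat.cast_sub (show 1 + i ≤ N by omega)]
      ring
    linear_combination h
  have h₂ : ∏ i ∈ Finset.range N, (1 + -(q ^ (3 - 5 * (N : ℤ))) * (q ^ 5) ^ (N + i)) =
      ∏ i ∈ Finset.range N, (1 - q ^ (5 * i + 3)) := by
    refine Finset.prod_congr rfl fun i _ ↦ ?_
    have h : q ^ (3 - 5 * (N : ℤ)) * (q ^ 5) ^ (N + i) = q ^ (5 * i + 3) := by
      rw [hp, ← zpow_natCast, ← zpow_add₀ hq]
      congr 1
      push_cast
      ring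
    linear_combination -h
  rw [← h₁, ← h₂, mul_assoc, key, prod_neg_pow_five_mul_add_two, Finset.mul_sum, two_mul]
  refine Finset.sum_congr rfl fun k _ ↦ ?_
  rw [← theta_coefficient q hq N k]
  ring

lemma norm_thetaTerm_le {q : ℝ} (hq0 : 0 < q) (hq1 : q < 1) (j : ℤ) :
    ‖thetaTerm q j‖ ≤ q ^ j.natAbs := by
  rw [thetaTerm, norm_mul, norm_zpow, norm_neg, norm_one, one_zpow, one_mul,
    Real.norm_of_nonneg (zpow_nonneg hq0.le _), ← zpow_natCast]
  refine zpow_le_zpow_right_of_le_one₀ hq0 hq1.le ?_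
  rw [Int.le_ediv_iff_mul_le two_pos, Int.natCast_natAbs]
  rcases abs_cases j with ⟨h, h'⟩ | ⟨h, h'⟩ <;> rw [h] <;> nlinarith [Int.le_self_sq j]

lemma summable_norm_thetaTerm {q : ℝ} (hq0 : 0 < q) (hq1 : q < 1) :
    Summable fun j ↦ ‖thetaTerm q j‖ := by
  refine Summable.of_nonneg_of_le (fun _ ↦ norm_nonneg _) (norm_thetaTerm_le hq0 hq1) ?_
  have h := summable_geometric_of_lt_one hq0.le hq1
  exact Summable.of_nat_of_neg (by simpa using h) (by simpa using h)

lemma multipliable_one_sub_pow_mul_add {q : ℝ} (hq0 : 0 < q) (hq1 : q < 1) {a : ℕ} (ha : 0 < a)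
    (b : ℕ) : Multipliable fun n : ℕ ↦ 1 - q ^ (a * n + b) := by
  simp_rw [sub_eq_add_neg]
  refine multipliable_one_add_of_summable ?_
  simp_rw [norm_neg, Real.norm_of_nonneg (pow_nonneg hq0.le _), pow_add, pow_mul]
  exact (summable_geometric_of_lt_one (by positivity) (pow_lt_one₀ hq0.le hq1 ha.ne')).mul_right _

lemma tprod_one_sub_pow_mul_add_ne_zero {q : ℝ} (hq0 : 0 < q) (hq1 : q < 1) {a b : ℕ}
    (ha : 0 < a) (hb : 0 < b) : ∏' n : ℕ, (1 - q ^ (a * n + b)) ≠ 0 := by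
  simp_rw [sub_eq_add_neg]
  refine tprod_one_add_ne_zero_of_summable (fun n ↦ ?_) ?_
  · rw [← sub_eq_add_neg]
    exact (sub_pos.2 (pow_lt_one₀ hq0.le hq1 (by omega))).ne'
  simp_rw [norm_neg, Real.norm_of_nonneg (pow_nonneg hq0.le _), pow_add, pow_mul]
  exact (summable_geometric_of_lt_one (by positivity) (pow_lt_one₀ hq0.le hq1 ha.ne')).mul_right _

lemma tendsto_qPoch {p : ℝ} (hp0 : 0 < p) (hp1 : p < 1) :
    Filter.Tendsto (qPoch p) Filter.atTop (nhds (eulerProd p)) := by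
  have := (multipliable_one_sub_pow_mul_add hp0 hp1 one_pos 1).hasProd.tendsto_prod_nat
  simp only [one_mul] at this
  exact this

lemma eulerProd_ne_zero {p : ℝ} (hp0 : 0 < p) (hp1 : p < 1) : eulerProd p ≠ 0 := by
  simpa [eulerProd] using tprod_one_sub_pow_mul_add_ne_zero hp0 hp1 one_pos one_pos

lemma qPoch_pos {p : ℝ} (hp0 : 0 < p) (hp1 : p < 1) (n : ℕ) : 0 < qPoch p n :=
  Finset.prod_pos fun _ _ ↦ sub_pos.2 (pow_lt_one₀ hp0.le hp1 (by omega))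

lemma antitone_qPoch {p : ℝ} (hp0 : 0 < p) (hp1 : p < 1) : Antitone (qPoch p) := by
  refine antitone_nat_of_succ_le fun n ↦ ?_
  rw [qPoch_succ]
  exact mul_le_of_le_one_right (qPoch_pos hp0 hp1 n).le (sub_le_self _ (by positivity))

lemma eulerProd_pos {p : ℝ} (hp0 : 0 < p) (hp1 : p < 1) : 0 < eulerProd p :=
  (ge_of_tendsto' (tendsto_qPoch hp0 hp1) fun n ↦ (qPoch_pos hp0 hp1 n).le).lt_of_ne'
    (eulerProd_ne_zero hp0 hp1)

lemma gaussBinom_eq_div {p : ℝ} (hp0 : 0 < p) (hp1 : p < 1) {n k m : ℕ} (h : k + m = n) :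
    gaussBinom p n k = qPoch p n / (qPoch p k * qPoch p m) := by
  subst h
  rw [eq_div_iff (mul_pos (qPoch_pos hp0 hp1 k) (qPoch_pos hp0 hp1 m)).ne', gaussBinom_mul_qPoch]

lemma norm_gaussBinom_le {p : ℝ} (hp0 : 0 < p) (hp1 : p < 1) (n k : ℕ) :
    ‖gaussBinom p n k‖ ≤ 1 / (eulerProd p * eulerProd p) := by
  have hE := eulerProd_pos hp0 hp1
  have hle (m : ℕ) : eulerProd p ≤ qPoch p m :=
    (antitone_qPoch hp0 hp1).le_of_tendsto (tendsto_qPoch hp0 hp1) m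
  rcases lt_or_ge n k with h | h
  · rw [gaussBinom_eq_zero_of_lt p h, norm_zero]
    positivity
  obtain ⟨m, rfl⟩ := Nat.exists_eq_add_of_le h
  have hk := qPoch_pos hp0 hp1 k
  have hm := qPoch_pos hp0 hp1 m
  have hkm := qPoch_pos hp0 hp1 (k + m)
  rw [gaussBinom_eq_div hp0 hp1 rfl, Real.norm_of_nonneg (by positivity)]
  have h₁ : qPoch p (k + m) ≤ 1 := by
    simpa [qPoch] using antitone_qPoch hp0 hp1 (Nat.zero_le (k + m))
  gcongr
  exacts [hle k, hle m]

lemma tendsto_gaussBinom {p : ℝ} (hp0 : 0 < p) (hp1 : p < 1) (j : ℤ) :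
    Filter.Tendsto (fun N : ℕ ↦ gaussBinom p (2 * N) (N + j).toNat) Filter.atTop
      (nhds (eulerProd p)⁻¹) := by
  have hE := eulerProd_ne_zero hp0 hp1
  have hshift (i : ℤ) : Filter.Tendsto (fun N : ℕ ↦ (N + i).toNat) Filter.atTop Filter.atTop :=
    Filter.tendsto_atTop.2 fun b ↦ Filter.eventually_atTop.2 ⟨b + i.natAbs, fun N hN ↦ by omega⟩
  have hdouble : Filter.Tendsto (fun N : ℕ ↦ 2 * N) Filter.atTop Filter.atTop :=
    Filter.tendsto_atTop.2 fun b ↦ Filter.eventually_atTop.2 ⟨b, fun N hN ↦ by omega⟩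
  have hT := tendsto_qPoch hp0 hp1
  have hlim := (hT.comp hdouble).div ((hT.comp (hshift j)).mul (hT.comp (hshift (-j))))
    (mul_ne_zero hE hE)
  rw [div_mul_cancel_left₀ hE] at hlim
  refine hlim.congr' (Filter.eventually_atTop.2 ⟨j.natAbs, fun N hN ↦ ?_⟩)
  have hadd : (N + j).toNat + (N + -j).toNat = 2 * N := by omega
  exact (gaussBinom_eq_div hp0 hp1 hadd).symm

/-- The Jacobi triple product `(q²; q⁵)_∞ (q³; q⁵)_∞ (q⁵; q⁵)_∞ = ∑ (-1)^j q^(j(5j+1)/2)`. -/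
lemma tprod_mul_tprod_mul_eulerProd {q : ℝ} (hq0 : 0 < q) (hq1 : q < 1) :
    (∏' n : ℕ, (1 - q ^ (5 * n + 2))) * (∏' n : ℕ, (1 - q ^ (5 * n + 3))) * eulerProd (q ^ 5) =
      ∑' j : ℤ, thetaTerm q j := by
  have hp0 : 0 < q ^ 5 := by positivity
  have hp1 : q ^ 5 < 1 := pow_lt_one₀ hq0.le hq1 (by norm_num)
  have hprod (b : ℕ) :=
    (multipliable_one_sub_pow_mul_add hq0 hq1 (show 0 < 5 by norm_num) b).hasProd.tendsto_prod_nat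
  have hleft := (hprod 2).mul (hprod 3)
  let f (N : ℕ) (j : ℤ) : ℝ :=
    if -(N : ℤ) ≤ j then gaussBinom (q ^ 5) (2 * N) (N + j).toNat * thetaTerm q j else 0
  have hsum (N : ℕ) : ∑' j, f N j = (∏ i ∈ Finset.range N, (1 - q ^ (5 * i + 2))) *
      ∏ i ∈ Finset.range N, (1 - q ^ (5 * i + 3)) := by
    rw [prod_mul_prod_eq_sum_thetaTerm q hq0.ne',
      tsum_eq_sum (s := (Finset.range (2 * N + 1)).image fun k : ℕ ↦ (k : ℤ) - N),
      Finset.sum_image (fun a _ b _ h ↦ by simpa using h)]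
    · refine Finset.sum_congr rfl fun k _ ↦ ?_
      simp [f]
    · intro j hj
      simp only [f]
      split_ifs with h
      · rw [gaussBinom_eq_zero_of_lt, zero_mul]
        by_contra hlt
        exact hj (Finset.mem_image.2 ⟨(N + j).toNat, Finset.mem_range.2 (by omega), by omega⟩)
      · rfl
  have hright : Filter.Tendsto (fun N ↦ ∑' j, f N j) Filter.atTop
      (nhds (∑' j, (eulerProd (q ^ 5))⁻¹ * thetaTerm q j)) := by
    refine tendsto_tsum_of_dominated_convergence
      ((summable_norm_thetaTerm hq0 hq1).mul_left
        (1 / (eulerProd (q ^ 5) * eulerProd (q ^ 5)))) (fun j ↦ ?_) (.of_forall fun N j ↦ ?_)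
    · refine ((tendsto_gaussBinom hp0 hp1 j).mul_const _).congr'
        (Filter.eventually_atTop.2 ⟨j.natAbs, fun N hN ↦ ?_⟩)
      exact (if_pos (by omega)).symm
    · simp only [f]
      split_ifs
      · rw [norm_mul]
        gcongr
        exact norm_gaussBinom_le hp0 hp1 _ _
      · have hE := eulerProd_pos hp0 hp1
        rw [norm_zero]
        positivity
  simp_rw [hsum] at hright
  rw [tendsto_nhds_unique hleft hright, tsum_mul_left, mul_comm,
    mul_inv_cancel_left₀ (eulerProd_ne_zero hp0 hp1)]

lemma thetaTerm_two_mul (q : ℝ) (k : ℤ) : thetaTerm q (2 * k) = q ^ (10 * k ^ 2 + k) := by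
  rw [thetaTerm, Even.neg_one_zpow (even_two_mul k), one_mul,
    show 2 * k * (5 * (2 * k) + 1) = 2 * (10 * k ^ 2 + k) by ring,
    Int.mul_ediv_cancel_left _ two_ne_zero]

lemma thetaTerm_odd (q : ℝ) (k : ℤ) :
    thetaTerm q (2 * (-k - 1) + 1) = -q ^ (10 * k ^ 2 + 9 * k + 2) := by
  rw [thetaTerm, Odd.neg_one_zpow (odd_two_mul_add_one _), neg_one_mul,
    show (2 * (-k - 1) + 1) * (5 * (2 * (-k - 1) + 1) + 1) = 2 * (10 * k ^ 2 + 9 * k + 2) by ring,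
    Int.mul_ediv_cancel_left _ two_ne_zero]

lemma tsum_thetaTerm {q : ℝ} (hq0 : 0 < q) (hq1 : q < 1) :
    ∑' j, thetaTerm q j =
      ∑' k : ℤ, ((q ^ (10 * k ^ 2 + k) : ℝ) - (q ^ (10 * k ^ 2 + 9 * k + 2) : ℝ)) := by
  have hs : Summable (thetaTerm q) := (summable_norm_thetaTerm hq0 hq1).of_norm
  have he : Function.Injective fun k : ℤ ↦ 2 * k := fun a b h ↦ by simpa using h
  have ho : Function.Injective fun k : ℤ ↦ 2 * (-k - 1) + 1 := fun a b h ↦ by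
    simp only at h; omega
  have hse := hs.comp_injective he
  have hso := hs.comp_injective ho
  have hcompl : IsCompl (Set.range fun k : ℤ ↦ 2 * k)
      (Set.range fun k : ℤ ↦ 2 * (-k - 1) + 1) := by
    rw [← compl_eq_iff_isCompl]
    ext j
    simp only [Set.mem_compl_iff, Set.mem_range]
    constructor
    · intro h
      rcases Int.even_or_odd' j with ⟨m, hm | hm⟩
      · exact absurd ⟨m, hm.symm⟩ h
      · exact ⟨-m - 1, by omega⟩
    · rintro ⟨k, hk⟩ ⟨m, hm⟩
      omega
  have h := HasSum.add_isCompl (f := thetaTerm q) hcompl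
    (he.hasSum_range_iff.2 hse.hasSum) (ho.hasSum_range_iff.2 hso.hasSum)
  rw [h.tsum_eq, ← hse.tsum_add hso]
  refine tsum_congr fun k ↦ ?_
  simp only [Function.comp_apply]
  rw [thetaTerm_two_mul, thetaTerm_odd, ← sub_eq_add_neg]

lemma prod_range_five_mul (f : ℕ → ℝ) (N : ℕ) :
    ∏ i ∈ Finset.range (5 * N), f i =
      ∏ n ∈ Finset.range N,
        (f (5 * n) * f (5 * n + 1) * f (5 * n + 2) * f (5 * n + 3) * f (5 * n + 4)) := by
  induction N with
  | zero => simp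
  | succ N ih =>
    rw [Finset.prod_range_succ, ← ih, mul_add, mul_one]
    simp only [Finset.prod_range_succ, mul_assoc]

lemma eulerProd_eq_mul_tprod {q : ℝ} (hq0 : 0 < q) (hq1 : q < 1) :
    eulerProd q = ((∏' n : ℕ, (1 - q ^ (5 * n + 1))) * ∏' n : ℕ, (1 - q ^ (5 * n + 4))) *
      ((∏' n : ℕ, (1 - q ^ (5 * n + 2))) * (∏' n : ℕ, (1 - q ^ (5 * n + 3))) *
        eulerProd (q ^ 5)) := by
  have hprod (b : ℕ) :=
    (multipliable_one_sub_pow_mul_add hq0 hq1 (show 0 < 5 by norm_num) b).hasProd.tendsto_prod_nat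
  have hfive : Filter.Tendsto (fun N : ℕ ↦ 5 * N) Filter.atTop Filter.atTop :=
    Filter.tendsto_atTop.2 fun b ↦ Filter.eventually_atTop.2 ⟨b, fun N hN ↦ by omega⟩
  have hp := tendsto_qPoch (p := q ^ 5) (by positivity) (pow_lt_one₀ hq0.le hq1 (by norm_num))
  refine tendsto_nhds_unique ((tendsto_qPoch hq0 hq1).comp hfive)
    ((((hprod 1).mul (hprod 4)).mul (((hprod 2).mul (hprod 3)).mul hp)).congr fun N ↦ ?_)
  simp only [Function.comp_apply, qPoch, prod_range_five_mul, ← Finset.prod_mul_distrib]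
  refine Finset.prod_congr rfl fun n _ ↦ ?_
  rw [← pow_mul]
  ring

theorem rogers_ramanujan_chi_2_5_1_2 (q : ℝ) (hq0 : 0 < q) (hq1 : q < 1) :
    minChar 2 5 1 2 q =
      q ^ (-(1 : ℝ) / 60) * ∏' n : ℕ, ((1 - q ^ (5 * n + 1)) * (1 - q ^ (5 * n + 4)))⁻¹ ∧
    (eulerProd q)⁻¹ *
        (∑' k : ℤ, ((q ^ (10 * k ^ 2 + k) : ℝ) - (q ^ (10 * k ^ 2 + 9 * k + 2) : ℝ))) =
      ∏' n : ℕ, ((1 - q ^ (5 * n + 1)) * (1 - q ^ (5 * n + 4)))⁻¹ := by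
  have main : (eulerProd q)⁻¹ *
        (∑' k : ℤ, ((q ^ (10 * k ^ 2 + k) : ℝ) - (q ^ (10 * k ^ 2 + 9 * k + 2) : ℝ))) =
      ∏' n : ℕ, ((1 - q ^ (5 * n + 1)) * (1 - q ^ (5 * n + 4)))⁻¹ := by
    have hne (b : ℕ) (hb : 0 < b) :=
      tprod_one_sub_pow_mul_add_ne_zero hq0 hq1 (show 0 < 5 by norm_num) hb
    have hp := eulerProd_ne_zero (p := q ^ 5) (by positivity)
      (pow_lt_one₀ hq0.le hq1 (by norm_num))
    have hinv : HasProd (fun n : ℕ ↦ ((1 - q ^ (5 * n + 1)) * (1 - q ^ (5 * n + 4)))⁻¹)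
        ((∏' n : ℕ, (1 - q ^ (5 * n + 1))) * ∏' n : ℕ, (1 - q ^ (5 * n + 4)))⁻¹ := by
      have hmul := (multipliable_one_sub_pow_mul_add hq0 hq1 (show 0 < 5 by norm_num) 1).hasProd.mul
        (multipliable_one_sub_pow_mul_add hq0 hq1 (show 0 < 5 by norm_num) 4).hasProd
      have := Filter.Tendsto.inv₀ hmul (mul_ne_zero (hne 1 (by norm_num)) (hne 4 (by norm_num)))
      exact this.congr fun s ↦ (Finset.prod_inv_distrib _).symm
    rw [hinv.tprod_eq, ← tsum_thetaTerm hq0 hq1, ← tprod_mul_tprod_mul_eulerProd hq0 hq1,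
      eulerProd_eq_mul_tprod hq0 hq1, mul_inv, mul_assoc, inv_mul_cancel₀, mul_one]
    exact mul_ne_zero (mul_ne_zero (hne 2 (by norm_num)) (hne 3 (by norm_num))) hp
  refine ⟨?_, main⟩
  rw [← main, minChar, mul_assoc]
  congr 1
  · congr 1
    norm_num
  · congr 1
    refine tsum_congr fun k ↦ ?_
    congr 2
    ring
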